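/- TS(2,1) = (π/2) ∫₀² (arctan u)/u du − (7/5)·ζ(3); that is, ∫₀¹ arctan(2x)·arcsin(x)/x dx = (π/2) ∫₀² (arctan u)/u du − (7/5)·∑_{n=1}^∞ 1/n³. -/

import Mathlib

open Real MeasureTheory intervalIntegral

/-- The polylogarithm `∑ xⁿ / nᵏ` of order `k` on the real line. -/
noncomputable def polylog (k : ℕ) (x : ℝ) : ℝ := ∑' n : ℕ, x ^ (n + 1) / ((n : ℝ) + 1) ^ k

theorem summable_inv_succ_pow {k : ℕ} (hk : 2 ≤ k) :
    Summable fun n : ℕ => 1 / ((n : ℝ) + 1) ^ k := by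
  have := (summable_nat_add_iff 1).2 (Real.summable_one_div_nat_pow.2 (show 1 < k by omega))
  simpa using this

theorem norm_polylog_term_le (k n : ℕ) {x : ℝ} (hx : |x| ≤ 1) :
    ‖x ^ (n + 1) / ((n : ℝ) + 1) ^ k‖ ≤ 1 / ((n : ℝ) + 1) ^ k := by
  rw [norm_div, norm_pow, Real.norm_eq_abs, Real.norm_of_nonneg (by positivity)]
  gcongr
  exact pow_le_one₀ (abs_nonneg x) hx

theorem summable_polylog {k : ℕ} (hk : 2 ≤ k) {x : ℝ} (hx : |x| ≤ 1) :
    Summable fun n : ℕ => x ^ (n + 1) / ((n : ℝ) + 1) ^ k :=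
  Summable.of_norm_bounded (summable_inv_succ_pow hk) fun n => norm_polylog_term_le k n hx

theorem polylog_zero_right (k : ℕ) : polylog k 0 = 0 := by
  simp [polylog]

theorem polylog_one_left {x : ℝ} (hx : |x| < 1) : polylog 1 x = -log (1 - x) := by
  simpa [polylog] using (Real.hasSum_pow_div_log_of_abs_lt_one hx).tsum_eq

theorem continuousOn_polylog {k : ℕ} (hk : 2 ≤ k) :
    ContinuousOn (polylog k) (Set.Icc (-1) 1) :=
  continuousOn_tsum (fun n => by fun_prop) (summable_inv_succ_pow hk)
    fun n _ hx => norm_polylog_term_le k n (abs_le.2 hx)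

theorem hasDerivAt_polylog_succ (k : ℕ) {x : ℝ} (hx : |x| < 1) (hx0 : x ≠ 0) :
    HasDerivAt (polylog (k + 1)) (polylog k x / x) x := by
  obtain ⟨r, hxr, hr⟩ := exists_between hx
  have hr0 : 0 ≤ r := (abs_nonneg x).trans hxr.le
  have hderiv : HasDerivAt (polylog (k + 1)) (∑' n : ℕ, x ^ n / ((n : ℝ) + 1) ^ k) x := by
    refine hasDerivAt_tsum_of_isPreconnected (t := Metric.ball (0 : ℝ) r) (y₀ := 0)
      (g := fun (n : ℕ) z => z ^ (n + 1) / ((n : ℝ) + 1) ^ (k + 1))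
      (g' := fun (n : ℕ) z => z ^ n / ((n : ℝ) + 1) ^ k) (summable_geometric_of_lt_one hr0 hr)
      Metric.isOpen_ball (convex_ball (0 : ℝ) r).isPreconnected (fun n y _ => ?_) (fun n y hy => ?_) ?_ ?_ ?_
    · have h := (hasDerivAt_pow (n + 1) y).div_const (((n : ℝ) + 1) ^ (k + 1))
      refine h.congr_deriv ?_
      have : (n : ℝ) + 1 ≠ 0 := by positivity
      push_cast
      field_simp
      ring
    · have hy' : |y| < r := by simpa using hy
      rw [norm_div, norm_pow, Real.norm_eq_abs, Real.norm_of_nonneg (by positivity)]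
      refine (div_le_self (by positivity)
        (one_le_pow₀ (by linarith [n.cast_nonneg (α := ℝ)]))).trans ?_
      gcongr
    · simpa using (abs_nonneg x).trans_lt hxr
    · simp
    · simpa using hxr
  refine hderiv.congr_deriv ?_
  rw [polylog, ← tsum_div_const]
  congr 1 with n
  field_simp
  ring

theorem hasDerivAt_polylog_two {x : ℝ} (hx : |x| < 1) (hx0 : x ≠ 0) :
    HasDerivAt (polylog 2) (-log (1 - x) / x) x := by
  rw [← polylog_one_left hx]
  exact hasDerivAt_polylog_succ 1 hx hx0

theorem polylog_add_polylog_neg {k : ℕ} (hk : 2 ≤ k) {x : ℝ} (hx : |x| ≤ 1) :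
    polylog k x + polylog k (-x) = 2 / 2 ^ k * polylog k (x ^ 2) := by
  rw [polylog, polylog, ← (summable_polylog hk hx).tsum_add
    (summable_polylog hk (x := -x) (by simpa using hx)), polylog, ← tsum_mul_left]
  refine ((Function.Injective.tsum_eq (g := fun n : ℕ => 2 * n + 1)
    (fun a b h => by simpa using h) (fun n hn => ?_)).symm.trans ?_)
  · rcases Nat.even_or_odd n with h | h
    · exact absurd (by simp [h.add_one.neg_pow, neg_div]) hn
    · obtain ⟨m, rfl⟩ := h
      exact ⟨m, rfl⟩
  · congr 1 with n
    have h : Even (2 * n + 1 + 1) := ⟨n + 1, by ring⟩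
    rw [h.neg_pow, ← pow_mul]
    have : ((2 * n + 1 : ℕ) : ℝ) + 1 = 2 * ((n : ℝ) + 1) := by push_cast; ring
    rw [this, mul_pow]
    have : (n : ℝ) + 1 ≠ 0 := by positivity
    field_simp
    ring

/-- A function with zero derivative inside an interval has equal values at the endpoints. -/
theorem eq_of_hasDerivAt_zero {f : ℝ → ℝ} {a b : ℝ} (hab : a < b)
    (hf : ContinuousOn f (Set.Icc a b)) (hf' : ∀ x ∈ Set.Ioo a b, HasDerivAt f 0 x) :
    f a = f b := by
  obtain ⟨c, -, hc⟩ := exists_hasDerivAt_eq_slope f (fun _ => 0) hab hf hf'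
  have : b - a ≠ 0 := by linarith
  field_simp at hc
  linarith

theorem continuousOn_log_mul_log_one_sub_sq :
    ContinuousOn (fun s : ℝ => log s * log (1 - s) ^ 2) (Set.Iio 1) := by
  have hslope : ContinuousOn (dslope (fun s : ℝ => log (1 - s)) 0) (Set.Iio 1) := by
    refine (continuousOn_dslope (Iio_mem_nhds one_pos)).2 ⟨fun s hs => ?_, ?_⟩
    · have : (1 : ℝ) - s ≠ 0 := by have := Set.mem_Iio.1 hs; linarith
      exact ContinuousAt.continuousWithinAt (by fun_prop (disch := assumption))
    · fun_prop (disch := norm_num)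
  refine ((Real.continuous_mul_log.continuousOn.mul hslope).mul
    (f := fun s => s * log s * dslope (fun s : ℝ => log (1 - s)) 0 s)
    (g := fun s => log (1 - s)) fun s hs => ?_).congr fun s _ => ?_
  · have : (1 : ℝ) - s ≠ 0 := by have := Set.mem_Iio.1 hs; linarith
    exact ContinuousAt.continuousWithinAt (by fun_prop (disch := assumption))
  · have h := sub_smul_dslope (fun s : ℝ => log (1 - s)) 0 s
    simp only [sub_zero, log_one, smul_eq_mul] at h
    simp only [Pi.mul_apply]
    linear_combination (-(log s * log (1 - s))) * h

theorem hasDerivAt_polylog_succ_comp (k : ℕ) {f : ℝ → ℝ} {f' x : ℝ} (hf : HasDerivAt f f' x)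
    (hx : |f x| < 1) (hx0 : f x ≠ 0) :
    HasDerivAt (fun y => polylog (k + 1) (f y)) (polylog k (f x) / f x * f') x :=
  (hasDerivAt_polylog_succ k hx hx0).comp x hf

theorem hasDerivAt_polylog_two_comp {f : ℝ → ℝ} {f' x : ℝ} (hf : HasDerivAt f f' x)
    (hx : |f x| < 1) (hx0 : f x ≠ 0) :
    HasDerivAt (fun y => polylog 2 (f y)) (-log (1 - f x) / f x * f') x :=
  (hasDerivAt_polylog_two hx hx0).comp x hf

theorem continuousOn_polylog_comp {k : ℕ} (hk : 2 ≤ k) {f : ℝ → ℝ} {s : Set ℝ}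
    (hf : ContinuousOn f s) (hs : ∀ x ∈ s, |f x| ≤ 1) :
    ContinuousOn (fun y => polylog k (f y)) s :=
  (continuousOn_polylog hk).comp hf fun x hx => abs_le.1 (hs x hx)

theorem abs_one_sub_inv_lt_one {x : ℝ} (hx : 1 / 2 < x) (hx1 : x ≤ 1) : |1 - x⁻¹| < 1 := by
  have h1 : x⁻¹ < 2 := by
    rw [inv_lt_comm₀ (by linarith) (by norm_num)]; linarith
  have h2 : 1 ≤ x⁻¹ := (one_le_inv₀ (by linarith)).2 hx1
  rw [abs_lt]; constructor <;> linarith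

theorem hasDerivAt_one_sub_inv {x : ℝ} (hx : x ≠ 0) :
    HasDerivAt (fun y : ℝ => 1 - y⁻¹) (1 / x ^ 2) x := by
  refine ((hasDerivAt_inv hx).const_sub 1).congr_deriv ?_
  field_simp

/-- Landen's identity for the dilogarithm. -/
theorem polylog_two_landen {x : ℝ} (hx : 1 / 2 < x) (hx1 : x < 1) :
    polylog 2 (1 - x) + polylog 2 (1 - x⁻¹) = -(log x ^ 2 / 2) := by
  have key := eq_of_hasDerivAt_zero
    (f := fun y => polylog 2 (1 - y) + polylog 2 (1 - y⁻¹) + log y ^ 2 / 2) hx1 ?_ ?_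
  · simp only [sub_self, inv_one, polylog_zero_right, log_one] at key
    linarith
  · have hne : ∀ y ∈ Set.Icc x 1, y ≠ 0 := fun y hy => by have := hy.1; linarith
    refine ((continuousOn_polylog_comp le_rfl (by fun_prop) fun y hy => ?_).add
      (continuousOn_polylog_comp le_rfl ?_ fun y hy => ?_)).add ?_
    · have := hy.1; have := hy.2
      rw [abs_le]; constructor <;> linarith
    · exact continuousOn_const.sub (continuousOn_id.inv₀ hne)
    · exact (abs_one_sub_inv_lt_one (hx.trans_le hy.1) hy.2).le
    · exact ((continuousOn_id.log hne).pow 2).div_const 2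
  · rintro y ⟨hy, hy1⟩
    have hy0 : y ≠ 0 := by linarith
    have hy2 : 1 - y ≠ 0 := by linarith
    have hy3 : 1 - y⁻¹ = -((1 - y) / y) := by field_simp; ring
    have d1 := hasDerivAt_polylog_two_comp ((hasDerivAt_id y).const_sub 1)
      (by rw [abs_lt]; simp only [id]; constructor <;> linarith) hy2
    have d2 := hasDerivAt_polylog_two_comp (hasDerivAt_one_sub_inv hy0)
      (abs_one_sub_inv_lt_one (hx.trans hy) hy1.le)
      (by rw [hy3]; exact neg_ne_zero.2 (div_ne_zero hy2 hy0))
    have d3 := ((hasDerivAt_log hy0).pow 2).div_const 2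
    refine ((d1.add d2).add d3).congr_deriv ?_
    simp only [id, sub_sub_cancel, log_inv]
    rw [hy3]
    field_simp
    ring

/-- Landen's identity for the trilogarithm. -/
theorem polylog_three_landen {x : ℝ} (hx : 1 / 2 < x) (hx1 : x < 1) :
    polylog 3 x + polylog 3 (1 - x) + polylog 3 (1 - x⁻¹)
      - log x * (polylog 2 x - polylog 2 (1 - x⁻¹))
      = polylog 3 1 + log (1 - x) * log x ^ 2 / 2 - log x ^ 3 / 3 := by
  have key := eq_of_hasDerivAt_zero
    (f := fun y => polylog 3 y + polylog 3 (1 - y) + polylog 3 (1 - y⁻¹)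
      - log y * (polylog 2 y - polylog 2 (1 - y⁻¹)) - log (1 - y) * log y ^ 2 / 2
      + log y ^ 3 / 3) hx1 ?_ ?_
  · simp only [sub_self, inv_one, polylog_zero_right, log_one, log_zero] at key
    linarith
  · have hne : ∀ y ∈ Set.Icc x 1, y ≠ 0 := fun y hy => by have := hy.1; linarith
    have hlog : ContinuousOn log (Set.Icc x 1) := continuousOn_id.log hne
    have hinv : ContinuousOn (fun y : ℝ => 1 - y⁻¹) (Set.Icc x 1) :=
      continuousOn_const.sub (continuousOn_id.inv₀ hne)
    have habs : ∀ y ∈ Set.Icc x 1, |1 - y⁻¹| ≤ 1 := fun y hy =>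
      (abs_one_sub_inv_lt_one (hx.trans_le hy.1) hy.2).le
    have habs' : ∀ y ∈ Set.Icc x 1, |y| ≤ 1 := fun y hy => by
      have := hy.1; have := hy.2
      rw [abs_le]; constructor <;> linarith
    have habs'' : ∀ y ∈ Set.Icc x 1, |1 - y| ≤ 1 := fun y hy => by
      have := hy.1; have := hy.2
      rw [abs_le]; constructor <;> linarith
    have hmix : ContinuousOn (fun y : ℝ => log (1 - y) * log y ^ 2) (Set.Icc x 1) := by
      refine (continuousOn_log_mul_log_one_sub_sq.comp (f := fun y : ℝ => 1 - y)
        (by fun_prop) fun y hy => ?_).congr fun y _ => ?_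
      · have := hy.1
        simp only [Set.mem_Iio]; linarith
      · simp
    exact (((((continuousOn_polylog_comp (by norm_num) continuousOn_id habs').add
      (continuousOn_polylog_comp (by norm_num) (by fun_prop) habs'')).add
      (continuousOn_polylog_comp (by norm_num) hinv habs)).sub
      (hlog.mul ((continuousOn_polylog_comp le_rfl continuousOn_id habs').sub
        (continuousOn_polylog_comp le_rfl hinv habs)))).sub (hmix.div_const 2)).add
      ((hlog.pow 3).div_const 3)
  · rintro y ⟨hy, hy1⟩
    have hy0 : y ≠ 0 := by linarith
    have hy2 : 1 - y ≠ 0 := by linarith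
    have hy3 : 1 - y⁻¹ = -((1 - y) / y) := by field_simp; ring
    have ha1 : |y| < 1 := by rw [abs_lt]; constructor <;> linarith
    have ha2 : |1 - y| < 1 := by rw [abs_lt]; constructor <;> linarith
    have ha3 := abs_one_sub_inv_lt_one (hx.trans hy) hy1.le
    have hn3 : 1 - y⁻¹ ≠ 0 := by rw [hy3]; exact neg_ne_zero.2 (div_ne_zero hy2 hy0)
    have dsub := (hasDerivAt_id' y).const_sub 1
    have dinv := hasDerivAt_one_sub_inv hy0
    have dlog := hasDerivAt_log hy0
    have hd := ((((((hasDerivAt_polylog_succ 2 ha1 hy0).add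
      (hasDerivAt_polylog_succ_comp 2 dsub ha2 hy2)).add
      (hasDerivAt_polylog_succ_comp 2 dinv ha3 hn3)).sub
      (dlog.mul ((hasDerivAt_polylog_two ha1 hy0).sub
        (hasDerivAt_polylog_two_comp dinv ha3 hn3)))).sub
      (((dsub.log hy2).mul (dlog.pow 2)).div_const 2)).add ((dlog.pow 3).div_const 3))
    refine hd.congr_deriv ?_
    have hL := polylog_two_landen (hx.trans hy) hy1
    simp only [sub_sub_cancel, log_inv, Pi.sub_apply, Pi.pow_apply]
    rw [eq_sub_iff_add_eq.2 hL]
    rw [show 1 / y ^ 2 = (1 - y⁻¹) * (-(1 / (y * (1 - y)))) by rw [hy3]; field_simp]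
    generalize polylog 2 (1 - y⁻¹) = p
    generalize 1 - y⁻¹ = q at hn3
    field_simp
    ring

/-- The value of `∫₀¹ arctan (2 t x / (1 - t²)) arccos x / x dx` in terms of polylogarithms. -/
noncomputable def arctanArccosPrimitive (t : ℝ) : ℝ :=
  polylog 3 t - polylog 3 (-t)
    - (log (1 - t) + log (1 + t)) * (polylog 2 t - polylog 2 (-t))
    + (log t * log (1 + t) ^ 2 - 2 / 3 * log (1 + t) ^ 3
      - 2 * log (1 + t) * polylog 2 (1 + t)⁻¹ - 2 * polylog 3 (1 + t)⁻¹)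
    - (log t * log (1 - t) ^ 2 + 2 * log (1 - t) * polylog 2 (1 - t) - 2 * polylog 3 (1 - t))

theorem arctanArccosPrimitive_zero : arctanArccosPrimitive 0 = 0 := by
  simp [arctanArccosPrimitive]

theorem continuousOn_log_mul_log_one_add_sq :
    ContinuousOn (fun s : ℝ => log s * log (1 + s) ^ 2) (Set.Ioi (-1)) := by
  refine (continuousOn_log_mul_log_one_sub_sq.comp (f := fun y : ℝ => -y)
    (by fun_prop) fun y hy => ?_).congr fun y _ => ?_
  · have := Set.mem_Ioi.1 hy
    simp only [Set.mem_Iio]; linarith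
  · simp

theorem continuousOn_arctanArccosPrimitive {a : ℝ} (ha : a < 1) :
    ContinuousOn arctanArccosPrimitive (Set.Icc 0 a) := by
  have hsub : ∀ y ∈ Set.Icc 0 a, 1 - y ≠ 0 := fun y hy => by have := hy.2; linarith
  have hadd : ∀ y ∈ Set.Icc 0 a, 1 + y ≠ 0 := fun y hy => by have := hy.1; linarith
  have hls : ContinuousOn (fun y : ℝ => log (1 - y)) (Set.Icc 0 a) :=
    ContinuousOn.log (by fun_prop) hsub
  have hla : ContinuousOn (fun y : ℝ => log (1 + y)) (Set.Icc 0 a) :=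
    ContinuousOn.log (by fun_prop) hadd
  have hinv : ContinuousOn (fun y : ℝ => (1 + y)⁻¹) (Set.Icc 0 a) :=
    ContinuousOn.inv₀ (by fun_prop) hadd
  have hneg : ContinuousOn (fun y : ℝ => -y) (Set.Icc 0 a) := by fun_prop
  have hsb : ContinuousOn (fun y : ℝ => 1 - y) (Set.Icc 0 a) := by fun_prop
  have hm1 := continuousOn_log_mul_log_one_sub_sq.mono
    (fun y (hy : y ∈ Set.Icc 0 a) => Set.mem_Iio.2 (hy.2.trans_lt ha))
  have hm2 := continuousOn_log_mul_log_one_add_sq.mono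
    (fun y (hy : y ∈ Set.Icc 0 a) => Set.mem_Ioi.2 (neg_one_lt_zero.trans_le hy.1))
  have b1 : ∀ y ∈ Set.Icc 0 a, |y| ≤ 1 := fun y hy => by
    have := hy.1; have := hy.2; rw [abs_le]; constructor <;> linarith
  have b2 : ∀ y ∈ Set.Icc 0 a, |-y| ≤ 1 := fun y hy => by rw [abs_neg]; exact b1 y hy
  have b3 : ∀ y ∈ Set.Icc 0 a, |1 - y| ≤ 1 := fun y hy => by
    have := hy.1; have := hy.2; rw [abs_le]; constructor <;> linarith
  have b4 : ∀ y ∈ Set.Icc 0 a, |(1 + y)⁻¹| ≤ 1 := fun y hy => by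
    have := hy.1
    rw [abs_of_pos (by positivity)]
    exact inv_le_one_of_one_le₀ (by linarith)
  have h3 : 2 ≤ 3 := by norm_num
  exact (((((continuousOn_polylog_comp h3 continuousOn_id b1).sub
    (continuousOn_polylog_comp h3 hneg b2)).sub
    ((hls.add hla).mul ((continuousOn_polylog_comp le_rfl continuousOn_id b1).sub
      (continuousOn_polylog_comp le_rfl hneg b2))))).add
    (((hm2.sub (continuousOn_const.mul (hla.pow 3))).sub
      ((continuousOn_const.mul hla).mul (continuousOn_polylog_comp le_rfl hinv b4))).sub
      (continuousOn_const.mul (continuousOn_polylog_comp h3 hinv b4)))).sub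
    ((hm1.add ((continuousOn_const.mul hls).mul (continuousOn_polylog_comp le_rfl hsb b3))).sub
      (continuousOn_const.mul (continuousOn_polylog_comp h3 hsb b3)))

theorem hasDerivAt_arctanArccosPrimitive {t : ℝ} (ht : 0 < t) (ht1 : t < 1) :
    HasDerivAt arctanArccosPrimitive
      ((polylog 2 t - polylog 2 (-t)) * ((1 + t ^ 2) / (t * (1 - t ^ 2)))) t := by
  have ht0 : t ≠ 0 := ht.ne'
  have hnt : -t ≠ 0 := neg_ne_zero.2 ht0
  have hs : 1 - t ≠ 0 := by linarith
  have ha : 1 + t ≠ 0 := by linarith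
  have hi : (1 + t)⁻¹ ≠ 0 := inv_ne_zero ha
  have b1 : |t| < 1 := by rw [abs_lt]; constructor <;> linarith
  have b2 : |-t| < 1 := by rwa [abs_neg]
  have b3 : |1 - t| < 1 := by rw [abs_lt]; constructor <;> linarith
  have b4 : |(1 + t)⁻¹| < 1 := by
    rw [abs_of_pos (by positivity)]
    exact inv_lt_one_of_one_lt₀ (by linarith)
  have dn := hasDerivAt_neg' t
  have ds := (hasDerivAt_id' t).const_sub 1
  have da := (hasDerivAt_id' t).const_add 1
  have di := da.fun_inv ha
  have dl := hasDerivAt_log ht0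
  have dls := ds.log hs
  have dla := da.log ha
  have hd := (((((hasDerivAt_polylog_succ 2 b1 ht0).sub
    (hasDerivAt_polylog_succ_comp 2 dn b2 hnt)).sub
    ((dls.add dla).mul ((hasDerivAt_polylog_two b1 ht0).sub
      (hasDerivAt_polylog_two_comp dn b2 hnt))))).add
    ((((dl.mul (dla.pow 2)).sub ((dla.pow 3).const_mul (2 / 3))).sub
      ((dla.const_mul 2).mul (hasDerivAt_polylog_two_comp di b4 hi))).sub
      ((hasDerivAt_polylog_succ_comp 2 di b4 hi).const_mul 2))).sub
    (((dl.mul (dls.pow 2)).add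
      ((dls.const_mul 2).mul (hasDerivAt_polylog_two_comp ds b3 hs))).sub
      ((hasDerivAt_polylog_succ_comp 2 ds b3 hs).const_mul 2))
  refine hd.congr_deriv ?_
  have hlog : log (1 - (1 + t)⁻¹) = log t - log (1 + t) := by
    rw [← log_div ht0 ha]
    congr 1
    field_simp
    ring
  have hfac : 1 - t ^ 2 = (1 - t) * (1 + t) := by ring
  simp only [Pi.sub_apply, Pi.add_apply, Pi.pow_apply, sub_sub_cancel, sub_neg_eq_add, hlog]
  rw [hfac]
  generalize polylog 2 (1 + t)⁻¹ = p
  generalize polylog 2 (1 - t) = q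
  field_simp
  ring

theorem polylog_three_one : polylog 3 1 = ∑' n : ℕ, 1 / ((n : ℝ) + 1) ^ 3 := by
  simp [polylog]

theorem arctanArccosPrimitive_inv_goldenRatio :
    arctanArccosPrimitive goldenRatio⁻¹ = 7 / 5 * polylog 3 1 := by
  set g := goldenRatio⁻¹ with hg
  have hφ : 1 < goldenRatio := one_lt_goldenRatio
  have hφ2 : goldenRatio < 2 := goldenRatio_lt_two
  have hg0 : 0 < g := by positivity
  have hg1 : g < 1 := inv_lt_one_of_one_lt₀ hφ
  have hghalf : 1 / 2 < g := by
    rw [hg, one_div]; exact inv_strictAnti₀ (by positivity) hφ2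
  have hinv : g⁻¹ = 1 + g := by
    have h0 : goldenRatio ≠ 0 := goldenRatio_ne_zero
    rw [hg, inv_inv, ← mul_left_inj' h0, add_mul, inv_mul_cancel₀ h0, ← sq, goldenRatio_sq, one_mul]
  have hsq : 1 - g = g ^ 2 := by
    have : g * g⁻¹ = 1 := mul_inv_cancel₀ hg0.ne'
    rw [hinv] at this
    linarith
  have habs : |g| ≤ 1 := by rw [abs_of_pos hg0]; exact hg1.le
  have hL2 := polylog_two_landen hghalf hg1
  have hL3 := polylog_three_landen hghalf hg1
  have hD2 := polylog_add_polylog_neg le_rfl habs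
  have hD3 := polylog_add_polylog_neg (k := 3) (by norm_num) habs
  have hlog1 : log (1 + g) = -log g := by rw [← hinv, log_inv]
  have hone : 1 - g⁻¹ = -g := by rw [hinv]; ring
  have hinv' : (1 + g)⁻¹ = g := by rw [← hinv, inv_inv]
  rw [arctanArccosPrimitive, hlog1, hinv', hsq, log_pow]
  rw [hone, hsq] at hL2 hL3
  rw [log_pow] at hL3
  push_cast at hL3 ⊢
  linear_combination (7 / 5) * hL3 - (12 / 5) * hD3 + (12 / 5 * log g) * hD2
    - (14 / 5 * log g) * hL2

theorem hasDerivAt_arctan_mul (v c : ℝ) :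
    HasDerivAt (fun w => arctan (w * c)) (c / (1 + (v * c) ^ 2)) v := by
  refine ((hasDerivAt_id' v).mul_const c).arctan.congr_deriv ?_
  ring

theorem abs_div_one_add_sq_le (a b : ℝ) : |a / (1 + b ^ 2)| ≤ |a| := by
  rw [abs_div, abs_of_pos (by positivity : 0 < 1 + b ^ 2)]
  exact div_le_self (abs_nonneg a) (by nlinarith [sq_nonneg b])

theorem abs_arctan_le (x : ℝ) : |arctan x| ≤ |x| := by
  have h := Convex.norm_image_sub_le_of_norm_deriv_le (f := arctan) (C := 1) (s := Set.univ)
    (x := 0) (y := x) (fun y _ => differentiableAt_arctan y) (fun y _ => ?_) convex_univ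
    (Set.mem_univ _) (Set.mem_univ _)
  · simpa using h
  · rw [Real.deriv_arctan, Real.norm_eq_abs]
    simpa using abs_div_one_add_sq_le 1 y

theorem abs_arctan_mul_div_le (v x : ℝ) : |arctan (v * x) / x| ≤ |v| := by
  rcases eq_or_ne x 0 with rfl | hx
  · simp
  · rw [abs_div, div_le_iff₀ (abs_pos.2 hx), ← abs_mul]
    exact abs_arctan_le _

theorem intervalIntegrable_arctan_mul_div (v a b : ℝ) :
    IntervalIntegrable (fun x => arctan (v * x) / x) volume a b := by
  refine (intervalIntegrable_const (c := |v|)).mono_fun' ?_ ?_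
  · exact (by fun_prop : Measurable fun x : ℝ => arctan (v * x) / x).aestronglyMeasurable
  · exact Filter.Eventually.of_forall fun x => abs_arctan_mul_div_le v x

theorem intervalIntegrable_arctan_mul_arccos_div (v a b : ℝ) :
    IntervalIntegrable (fun x => arctan (v * x) * arccos x / x) volume a b := by
  refine ((intervalIntegrable_arctan_mul_div v a b).mul_continuousOn
    continuous_arccos.continuousOn).congr fun x _ => ?_
  ring

theorem hasDerivAt_integral_arctan_mul_cos (v : ℝ) :
    HasDerivAt (fun w => ∫ θ in (0 : ℝ)..π / 2, arctan (w * cos θ))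
      (∫ θ in (0 : ℝ)..π / 2, cos θ / (1 + (v * cos θ) ^ 2)) v := by
  have hcont : ∀ w : ℝ, Continuous fun θ : ℝ => arctan (w * cos θ) := fun w => by fun_prop
  have hcont' : Continuous fun θ : ℝ => cos θ / (1 + (v * cos θ) ^ 2) :=
    continuous_cos.div (by fun_prop) fun θ => by positivity
  refine (hasDerivAt_integral_of_dominated_loc_of_deriv_le (s := Set.univ)
    (F' := fun w θ => cos θ / (1 + (w * cos θ) ^ 2)) (bound := fun _ => 1) Filter.univ_mem
    (.of_forall fun w => (hcont w).aestronglyMeasurable) ((hcont v).intervalIntegrable _ _)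
    hcont'.aestronglyMeasurable ?_ intervalIntegrable_const ?_).2
  · exact .of_forall fun θ _ w _ => (abs_div_one_add_sq_le _ _).trans (abs_cos_le_one θ)
  · exact .of_forall fun θ _ w _ => hasDerivAt_arctan_mul w (cos θ)

theorem hasDerivAt_integral_arctan_mul_arccos_div (v : ℝ) :
    HasDerivAt (fun w => ∫ x in (0 : ℝ)..1, arctan (w * x) * arccos x / x)
      (∫ x in (0 : ℝ)..1, arccos x / (1 + (v * x) ^ 2)) v := by
  have hcont' : Continuous fun x : ℝ => arccos x / (1 + (v * x) ^ 2) :=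
    continuous_arccos.div (by fun_prop) fun θ => by positivity
  refine (hasDerivAt_integral_of_dominated_loc_of_deriv_le (s := Set.univ)
    (F' := fun w x => arccos x / (1 + (w * x) ^ 2)) (bound := fun _ => π) Filter.univ_mem
    (.of_forall fun w => ?_) (intervalIntegrable_arctan_mul_arccos_div v 0 1)
    hcont'.aestronglyMeasurable ?_ intervalIntegrable_const ?_).2
  · exact (by fun_prop : Measurable fun x : ℝ => arctan (w * x) * arccos x / x).aestronglyMeasurable
  · refine .of_forall fun x _ w _ => (abs_div_one_add_sq_le _ _).trans ?_
    rw [abs_of_nonneg (arccos_nonneg x)]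
    exact arccos_le_pi x
  · refine .of_forall fun x hx w _ => ?_
    rw [Set.uIoc_of_le zero_le_one] at hx
    have hx0 : x ≠ 0 := hx.1.ne'
    refine (((hasDerivAt_arctan_mul w x).mul_const (arccos x)).div_const x).congr_deriv ?_
    field_simp

theorem integral_arccos_div_one_add_sq {v : ℝ} (hv : v ≠ 0) :
    ∫ x in (0 : ℝ)..1, arccos x / (1 + (v * x) ^ 2)
      = (∫ θ in (0 : ℝ)..π / 2, arctan (v * cos θ)) / v := by
  have hpos : ∀ x : ℝ, 1 + (v * x) ^ 2 ≠ 0 := fun x => by positivity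
  have hcont : Continuous fun x : ℝ => arccos x / (1 + (v * x) ^ 2) :=
    continuous_arccos.div (by fun_prop) hpos
  have hsub := integral_comp_mul_deriv (a := 0) (b := π / 2) (f := cos) (f' := fun θ => -sin θ)
    (g := fun x => arccos x / (1 + (v * x) ^ 2)) (fun θ _ => hasDerivAt_cos θ)
    (by fun_prop) hcont
  rw [cos_zero, cos_pi_div_two, integral_symm 0 1] at hsub
  have hder : ∀ θ : ℝ, HasDerivAt (fun φ => arctan (v * cos φ) / v)
      (-sin θ / (1 + (v * cos θ) ^ 2)) θ := fun θ => by
    refine (((hasDerivAt_cos θ).const_mul v).arctan.div_const v).congr_deriv ?_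
    have := hpos (cos θ)
    field_simp
  have hparts := integral_mul_deriv_eq_deriv_mul (a := 0) (b := π / 2)
    (u := fun θ => θ) (u' := fun _ => 1) (fun θ _ => hasDerivAt_id' θ) (fun θ _ => hder θ)
    intervalIntegrable_const
    (Continuous.intervalIntegrable (by
      exact continuous_sin.neg.div (by fun_prop) fun θ => hpos (cos θ)) _ _)
  have hcongr : ∫ θ in (0 : ℝ)..π / 2,
      ((fun x => arccos x / (1 + (v * x) ^ 2)) ∘ cos) θ * -sin θ
      = ∫ θ in (0 : ℝ)..π / 2, θ * (-sin θ / (1 + (v * cos θ) ^ 2)) := by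
    refine integral_congr fun θ hθ => ?_
    rw [Set.uIcc_of_le (by positivity)] at hθ
    simp only [Function.comp_apply]
    rw [arccos_cos hθ.1 (by linarith [hθ.2, pi_pos])]
    ring
  rw [hcongr, hparts] at hsub
  simp only [cos_pi_div_two, one_mul, mul_zero, zero_mul, zero_div, arctan_zero, sub_zero,
    zero_sub, neg_inj, intervalIntegral.integral_div] at hsub
  exact hsub.symm

theorem hasDerivAt_two_mul_div_one_sub_sq {t : ℝ} (ht : 1 - t ^ 2 ≠ 0) :
    HasDerivAt (fun s : ℝ => 2 * s / (1 - s ^ 2)) (2 * (1 + t ^ 2) / (1 - t ^ 2) ^ 2) t := by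
  refine (((hasDerivAt_id' t).const_mul 2).fun_div ((hasDerivAt_pow 2 t).const_sub 1)
    ht).congr_deriv ?_
  field_simp
  norm_num
  ring

theorem integral_cos_div_one_add_sq {t : ℝ} (ht : 0 < t) (ht1 : t < 1) :
    (∫ θ in (0 : ℝ)..π / 2, cos θ / (1 + (2 * t / (1 - t ^ 2) * cos θ) ^ 2))
      * (2 * (1 + t ^ 2) / (1 - t ^ 2) ^ 2) = (log (1 + t) - log (1 - t)) / t := by
  have hsq : 1 - t ^ 2 ≠ 0 := by nlinarith
  have hp : ∀ θ : ℝ, 1 + t ^ 2 + 2 * t * sin θ ≠ 0 := fun θ => by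
    nlinarith [neg_one_le_sin θ, mul_pos ht (sub_pos.2 ht1), sq_pos_of_pos (sub_pos.2 ht1)]
  have hm : ∀ θ : ℝ, 1 + t ^ 2 - 2 * t * sin θ ≠ 0 := fun θ => by
    nlinarith [sin_le_one θ, mul_pos ht (sub_pos.2 ht1), sq_pos_of_pos (sub_pos.2 ht1)]
  have hder : ∀ θ : ℝ, HasDerivAt
      (fun φ => (log (1 + t ^ 2 + 2 * t * sin φ) - log (1 + t ^ 2 - 2 * t * sin φ)) / (2 * t))
      (cos θ / (1 + (2 * t / (1 - t ^ 2) * cos θ) ^ 2) * (2 * (1 + t ^ 2) / (1 - t ^ 2) ^ 2))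
      θ := fun θ => by
    have ds := (hasDerivAt_sin θ).const_mul (2 * t)
    refine ((((ds.const_add (1 + t ^ 2)).log (hp θ)).sub
      ((ds.const_sub (1 + t ^ 2)).log (hm θ))).div_const (2 * t)).congr_deriv ?_
    have hprod : 1 + (2 * t / (1 - t ^ 2) * cos θ) ^ 2
        = (1 + t ^ 2 + 2 * t * sin θ) * (1 + t ^ 2 - 2 * t * sin θ) / (1 - t ^ 2) ^ 2 := by
      field_simp
      linear_combination 4 * t ^ 2 * sin_sq_add_cos_sq θ
    rw [hprod]
    have := hp θ
    have := hm θ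
    field_simp
    ring
  rw [← intervalIntegral.integral_mul_const, integral_eq_sub_of_hasDerivAt (fun θ _ => hder θ)]
  · rw [sin_pi_div_two, sin_zero, show 1 + t ^ 2 + 2 * t * 1 = (1 + t) ^ 2 by ring,
      show 1 + t ^ 2 - 2 * t * 1 = (1 - t) ^ 2 by ring, log_pow, log_pow]
    push_cast
    field_simp
    ring_nf
  · refine Continuous.intervalIntegrable ?_ _ _
    exact (continuous_cos.div (by fun_prop) fun θ => by positivity).mul continuous_const

/-- The integral `∫₀^{π/2} arctan (2 t cos θ / (1 - t²)) dθ` is twice the Legendre chi function. -/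
theorem integral_arctan_mul_cos {t : ℝ} (ht : 0 < t) (ht1 : t < 1) :
    ∫ θ in (0 : ℝ)..π / 2, arctan (2 * t / (1 - t ^ 2) * cos θ)
      = polylog 2 t - polylog 2 (-t) := by
  have hd : ∀ s ∈ Set.Icc 0 t, HasDerivAt
      (fun s => ∫ θ in (0 : ℝ)..π / 2, arctan (2 * s / (1 - s ^ 2) * cos θ))
      ((∫ θ in (0 : ℝ)..π / 2, cos θ / (1 + (2 * s / (1 - s ^ 2) * cos θ) ^ 2))
        * (2 * (1 + s ^ 2) / (1 - s ^ 2) ^ 2)) s := fun s hs =>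
    HasDerivAt.comp (h := fun s : ℝ => 2 * s / (1 - s ^ 2)) s
      (hasDerivAt_integral_arctan_mul_cos (2 * s / (1 - s ^ 2)))
      (hasDerivAt_two_mul_div_one_sub_sq (by nlinarith [hs.1, hs.2]))
  have habs : ∀ s ∈ Set.Icc 0 t, |s| < 1 := fun s hs => by
    rw [abs_of_nonneg hs.1]; exact hs.2.trans_lt ht1
  have key := eq_of_hasDerivAt_zero
    (f := fun s => (∫ θ in (0 : ℝ)..π / 2, arctan (2 * s / (1 - s ^ 2) * cos θ))
      - (polylog 2 s - polylog 2 (-s))) ht ?_ ?_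
  · simp only [mul_zero, zero_div, zero_mul, arctan_zero, intervalIntegral.integral_zero, neg_zero,
      polylog_zero_right, sub_self] at key
    linarith
  · exact ContinuousOn.sub (fun s hs => (hd s hs).continuousAt.continuousWithinAt)
      ((continuousOn_polylog_comp le_rfl continuousOn_id fun s hs => (habs s hs).le).sub
        (continuousOn_polylog_comp le_rfl (by fun_prop) fun s hs => by
          rw [abs_neg]; exact (habs s hs).le))
  · rintro s ⟨hs, hst⟩
    have hmem : s ∈ Set.Icc 0 t := ⟨hs.le, hst.le⟩
    refine ((hd s hmem).sub ((hasDerivAt_polylog_two (habs s hmem) hs.ne').sub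
      (hasDerivAt_polylog_two_comp (hasDerivAt_neg' s) (by rw [abs_neg]; exact habs s hmem)
        (neg_ne_zero.2 hs.ne')))).congr_deriv ?_
    rw [integral_cos_div_one_add_sq hs (hst.trans ht1), sub_neg_eq_add]
    field_simp
    ring

theorem integral_arctan_mul_arccos_div {t : ℝ} (ht : 0 < t) (ht1 : t < 1) :
    ∫ x in (0 : ℝ)..1, arctan (2 * t / (1 - t ^ 2) * x) * arccos x / x
      = arctanArccosPrimitive t := by
  have hne : ∀ s ∈ Set.Icc 0 t, 1 - s ^ 2 ≠ 0 := fun s hs => by nlinarith [hs.1, hs.2]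
  have hd : ∀ s ∈ Set.Icc 0 t, HasDerivAt
      (fun s => ∫ x in (0 : ℝ)..1, arctan (2 * s / (1 - s ^ 2) * x) * arccos x / x)
      ((∫ x in (0 : ℝ)..1, arccos x / (1 + (2 * s / (1 - s ^ 2) * x) ^ 2))
        * (2 * (1 + s ^ 2) / (1 - s ^ 2) ^ 2)) s := fun s hs =>
    HasDerivAt.comp (h := fun s : ℝ => 2 * s / (1 - s ^ 2)) s
      (hasDerivAt_integral_arctan_mul_arccos_div (2 * s / (1 - s ^ 2)))
      (hasDerivAt_two_mul_div_one_sub_sq (hne s hs))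
  have key := eq_of_hasDerivAt_zero
    (f := fun s => (∫ x in (0 : ℝ)..1, arctan (2 * s / (1 - s ^ 2) * x) * arccos x / x)
      - arctanArccosPrimitive s) ht ?_ ?_
  · simp only [mul_zero, zero_div, zero_mul, arctan_zero, intervalIntegral.integral_zero,
      arctanArccosPrimitive_zero] at key
    linarith
  · exact ContinuousOn.sub (fun s hs => (hd s hs).continuousAt.continuousWithinAt)
      (continuousOn_arctanArccosPrimitive ht1)
  · rintro s ⟨hs, hst⟩
    have hmem : s ∈ Set.Icc 0 t := ⟨hs.le, hst.le⟩
    have hs1 := hst.trans ht1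
    have hs2 := hne s hmem
    refine ((hd s hmem).sub (hasDerivAt_arctanArccosPrimitive hs hs1)).congr_deriv ?_
    rw [integral_arccos_div_one_add_sq (div_ne_zero (by linarith) hs2),
      integral_arctan_mul_cos hs hs1]
    have hs0 := hs.ne'
    field_simp
    ring

theorem integral_arctan_two_mul_arccos_div :
    ∫ x in (0 : ℝ)..1, arctan (2 * x) * arccos x / x = 7 / 5 * polylog 3 1 := by
  have h0 : goldenRatio ≠ 0 := goldenRatio_ne_zero
  have h1 : goldenRatio⁻¹ < 1 := inv_lt_one_of_one_lt₀ one_lt_goldenRatio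
  have hv : 2 * goldenRatio⁻¹ / (1 - goldenRatio⁻¹ ^ 2) = 2 := by
    have : 1 - goldenRatio⁻¹ ^ 2 = goldenRatio⁻¹ := by
      rw [← mul_left_inj' (pow_ne_zero 2 h0), sub_mul, ← mul_pow, inv_mul_cancel₀ h0, sq, sq,
        inv_mul_cancel_left₀ h0, ← sq, goldenRatio_sq]
      ring
    rw [this, mul_div_cancel_right₀ _ (inv_ne_zero h0)]
  rw [← arctanArccosPrimitive_inv_goldenRatio,
    ← integral_arctan_mul_arccos_div (by positivity) h1, hv]

theorem integral_arctan_div_eq {v : ℝ} (hv : v ≠ 0) :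
    ∫ u in (0 : ℝ)..v, arctan u / u = ∫ x in (0 : ℝ)..1, arctan (v * x) / x := by
  have h := intervalIntegral.mul_integral_comp_mul_left (a := 0) (b := 1)
    (f := fun u => arctan u / u) v
  rw [mul_zero, mul_one] at h
  rw [← h, ← intervalIntegral.integral_const_mul]
  congr 1 with x
  field_simp

theorem TS_two_one_eval :
    (∫ x in (0:ℝ)..1, Real.arctan (2 * x) * Real.arcsin x / x) =
      (Real.pi / 2) * (∫ u in (0:ℝ)..2, Real.arctan u / u)
        - (7 / 5) * (∑' n : ℕ, 1 / ((n : ℝ) + 1) ^ 3) := by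
  rw [← polylog_three_one, ← integral_arctan_two_mul_arccos_div,
    integral_arctan_div_eq two_ne_zero, ← intervalIntegral.integral_const_mul,
    ← integral_sub ((intervalIntegrable_arctan_mul_div 2 0 1).const_mul _)
      (intervalIntegrable_arctan_mul_arccos_div 2 0 1)]
  congr 1 with x
  rw [arcsin_eq_pi_div_two_sub_arccos]
  ring
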